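/- arXiv:math/0408350 — 2 statements merged into one kernel-verified Lean document; each statement's English description precedes it below -/
import Mathlib

section
/- For every integer g ≥ 2, the determinant of the (g−1) × (g−1) matrix A of binomial coefficients with (k,l)-entry A_{k,l} = C(2g−2k, g−l) (for 1 ≤ k, l ≤ g−1, with the convention C(n, r) = 0 when r > n) equals 2^{g(g−1)/2}. -/
open Polynomial in
/-- Coefficients of `(X(2+X))^m`. -/
noncomputable def auxB (m j : ℕ) : ℚ := ((X * (2 + X) : ℚ[X]) ^ m).coeff j

open Polynomial in
theorem auxB_lt (m j : ℕ) (h : j < m) : auxB m j = 0 := by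
  unfold auxB
  rw [mul_pow, coeff_X_pow_mul', if_neg (by omega)]

open Polynomial in
theorem auxB_diag (m : ℕ) : auxB m m = 2 ^ m := by
  unfold auxB
  rw [mul_pow, coeff_X_pow_mul', if_pos le_rfl, Nat.sub_self, coeff_zero_eq_eval_zero]
  simp

open Polynomial in
theorem choose_expand (n i j : ℕ) (hi : i < n) :
    ((2 * (i + 1)).choose (j + 1) : ℚ) =
      ∑ m : Fin n, ((i + 1).choose ((m : ℕ) + 1) : ℚ) * auxB ((m : ℕ) + 1) (j + 1) := by
  have h1 : ((1 + X : ℚ[X]) ^ (2 * (i + 1))) = (X * (2 + X) + 1) ^ (i + 1) := by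
    rw [pow_mul]; congr 1; ring
  have h2 := congrArg (fun p => p.coeff (j + 1)) h1
  simp only [coeff_one_add_X_pow] at h2
  rw [h2, add_pow, finset_sum_coeff, Fin.sum_univ_eq_sum_range
    (fun m => ((i + 1).choose (m + 1) : ℚ) * auxB (m + 1) (j + 1)) n, Finset.sum_range_succ']
  have h3 : ∀ m, ((X * (2 + X) : ℚ[X]) ^ m * 1 ^ (i + 1 - m) * ((i + 1).choose m : ℚ[X])).coeff (j + 1)
      = ((i + 1).choose m : ℚ) * auxB m (j + 1) := by
    intro m
    rw [one_pow, mul_one, coeff_mul_natCast, mul_comm]; rfl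
  simp only [h3]
  have h4 : auxB 0 (j + 1) = 0 := by
    simp [auxB, coeff_one]
  rw [h4, mul_zero, add_zero]
  apply Finset.sum_subset
  · intro x hx
    simp only [Finset.mem_range] at *
    omega
  · intro x _ hx
    simp only [Finset.mem_range] at hx
    rw [Nat.choose_eq_zero_of_lt (by omega)]
    simp

theorem det_aux (n : ℕ) :
    Matrix.det (Matrix.of fun k l : Fin n =>
        ((2 * ((k : ℕ) + 1)).choose ((l : ℕ) + 1) : ℚ)) = 2 ^ ((n + 1) * n / 2) := by
  have h : (Matrix.of fun k l : Fin n => ((2 * ((k : ℕ) + 1)).choose ((l : ℕ) + 1) : ℚ)) =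
      (Matrix.of fun k m : Fin n => (((k : ℕ) + 1).choose ((m : ℕ) + 1) : ℚ)) *
      (Matrix.of fun m l : Fin n => auxB ((m : ℕ) + 1) ((l : ℕ) + 1)) := by
    ext k l
    rw [Matrix.mul_apply]
    exact choose_expand n k l k.2
  rw [h, Matrix.det_mul, Matrix.det_of_lowerTriangular, Matrix.det_of_upperTriangular]
  · simp only [Matrix.of_apply, Nat.choose_self, auxB_diag]
    rw [Finset.prod_pow_eq_pow_sum]
    simp only [Nat.cast_one, Finset.prod_const_one, one_mul]
    congr 1
    rw [Fin.sum_univ_eq_sum_range (fun m => m + 1) n]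
    have := Finset.sum_range_id (n + 1)
    rw [Finset.sum_range_succ'] at this
    simpa using this
  · intro a b hab
    have : (b : ℕ) < a := hab
    exact auxB_lt ((a : ℕ) + 1) ((b : ℕ) + 1) (by omega)
  · intro a b hab
    have : (a : ℕ) < b := hab
    rw [Matrix.of_apply, Nat.choose_eq_zero_of_lt (by omega)]
    simp

/-- The determinant of the `(g−1) × (g−1)` matrix of binomial coefficients with
`(k,l)`-entry `C(2g−2k, g−l)` (for `1 ≤ k, l ≤ g−1`) equals `2^{g(g−1)/2}`. -/
theorem det_binomial_matrix (g : ℕ) (hg : 2 ≤ g) :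
    Matrix.det (Matrix.of fun k l : Fin (g - 1) =>
        ((2 * g - 2 * ((k : ℕ) + 1)).choose (g - ((l : ℕ) + 1)) : ℚ)) =
      2 ^ (g * (g - 1) / 2) := by
  have h := det_aux (g - 1)
  rw [Nat.sub_add_cancel (by omega : 1 ≤ g)] at h
  rw [← h, ← Matrix.det_submatrix_equiv_self Fin.revPerm]
  congr 1
  ext k l
  have hk := k.2
  have hl := l.2
  simp only [Matrix.submatrix_apply, Matrix.of_apply, Fin.revPerm_apply, Fin.val_rev]
  congr 2 <;> omega
end

section
/- For every integer g ≥ 2, the determinant of the (g−1) × (g−1) matrix over ℚ with (k,l)-entry 1/(g−2k+l)! (for 1 ≤ k, l ≤ g−1, with the convention 1/n! := 0 for n < 0) equals 2^{g(g−1)/2} · (∏_{j=1}^{g−1} j!) / (∏_{k=1}^{g−1} (2k)!). -/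
theorem aux_arith (n : ℕ) :
    (∏ i ∈ Finset.range n, (((2 * i + 1).factorial : ℚ))⁻¹) *
      ((∏ i ∈ Finset.range n, (2 : ℚ) ^ i) * ∏ i ∈ Finset.range n, (i.factorial : ℚ)) =
      2 ^ ((n + 1) * n / 2) * (∏ j ∈ Finset.Icc 1 n, (j.factorial : ℚ)) /
        ∏ k ∈ Finset.Icc 1 n, ((2 * k).factorial : ℚ) := by
  induction n with
  | zero => simp
  | succ n ih =>
    have he : (n + 1 + 1) * (n + 1) / 2 = (n + 1) * n / 2 + (n + 1) := by
      rw [show (n + 1 + 1) * (n + 1) = (n + 1) * n + (n + 1) * 2 by ring]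
      exact Nat.add_mul_div_right _ _ (by norm_num)
    rw [Finset.prod_range_succ, Finset.prod_range_succ, Finset.prod_range_succ,
      Finset.prod_Icc_succ_top (by omega), Finset.prod_Icc_succ_top (by omega), he]
    have h1 : (((2 * n + 1).factorial : ℚ))⁻¹ * (2 ^ n * (n.factorial : ℚ)) =
        2 ^ (n + 1) * ((n + 1).factorial : ℚ) / ((2 * (n + 1)).factorial : ℚ) := by
      have h2 : ((2 * n + 1).factorial : ℚ) ≠ 0 := by positivity
      rw [show 2 * (n + 1) = (2 * n + 1) + 1 by ring, Nat.factorial_succ (2 * n + 1),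
        Nat.factorial_succ n]
      push_cast
      have h3 : (2 * (n : ℚ) + 1 + 1) ≠ 0 := by positivity
      field_simp
      ring
    calc _ = ((∏ i ∈ Finset.range n, (((2 * i + 1).factorial : ℚ))⁻¹) *
      ((∏ i ∈ Finset.range n, (2 : ℚ) ^ i) * ∏ i ∈ Finset.range n, (i.factorial : ℚ))) *
        ((((2 * n + 1).factorial : ℚ))⁻¹ * (2 ^ n * (n.factorial : ℚ))) := by ring
      _ = _ := by
        rw [ih, h1, div_mul_div_comm, pow_add]
        ring

theorem aux_vdm (m : ℕ) :
    (Matrix.of fun i j : Fin (m + 1) => ((2 * (i : ℕ) + 1).descFactorial j : ℚ)).det =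
      (∏ i ∈ Finset.range (m + 1), (2 : ℚ) ^ i) *
        ∏ i ∈ Finset.range (m + 1), (i.factorial : ℚ) := by
  have h := Matrix.det_eval_matrixOfPolynomials_eq_det_vandermonde
      (fun i : Fin (m + 1) => ((2 * (i : ℕ) + 1 : ℕ) : ℚ))
      (fun i => descPochhammer ℚ i)
      (fun i => descPochhammer_natDegree ℚ i)
      (fun i => monic_descPochhammer ℚ i)
  simp only [descPochhammer_eval_eq_descFactorial] at h
  rw [← h]
  have h2 := Matrix.det_vandermonde_add (fun i : Fin (m + 1) => (2 * (i : ℕ) : ℚ)) 1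
  push_cast
  rw [h2]
  have h3 := Matrix.det_mul_row (fun j : Fin (m + 1) => (2 : ℚ) ^ (j : ℕ))
    (Matrix.vandermonde fun i : Fin (m + 1) => ((i : ℕ) : ℚ))
  rw [Matrix.det_vandermonde_id_eq_superFactorial,
    Fin.prod_univ_eq_prod_range (fun j => (2 : ℚ) ^ j)] at h3
  rw [← Nat.cast_prod, Nat.prod_range_succ_factorial, ← h3]
  congr 1
  ext i j
  simp [Matrix.vandermonde_apply, mul_pow]

/-- The determinant of the `(g−1) × (g−1)` matrix over `ℚ` with `(k,l)`-entry
`1/(g−2k+l)!` (for `1 ≤ k, l ≤ g−1`, with `1/n! := 0` for `n < 0`) equals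
`2^{g(g−1)/2} · (∏_{j=1}^{g−1} j!) / (∏_{k=1}^{g−1} (2k)!)`. -/
theorem det_inverse_factorial_matrix (g : ℕ) (hg : 2 ≤ g) :
    Matrix.det (Matrix.of fun k l : Fin (g - 1) =>
        if h : (0 : ℤ) ≤ (g : ℤ) - 2 * ((k : ℕ) + 1) + ((l : ℕ) + 1) then
          ((((g : ℤ) - 2 * ((k : ℕ) + 1) + ((l : ℕ) + 1)).toNat.factorial : ℚ))⁻¹
        else 0) =
      2 ^ (g * (g - 1) / 2) * (∏ j ∈ Finset.Icc 1 (g - 1), (j.factorial : ℚ)) /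
        ∏ k ∈ Finset.Icc 1 (g - 1), ((2 * k).factorial : ℚ) := by
  obtain ⟨m, rfl⟩ : ∃ m, g = m + 1 + 1 := ⟨g - 2, by omega⟩
  simp only [Nat.add_sub_cancel]
  rw [← aux_arith (m + 1), ← aux_vdm m,
    ← Fin.prod_univ_eq_prod_range (fun i => (((2 * i + 1).factorial : ℚ))⁻¹),
    ← Matrix.det_mul_column, ← Matrix.det_submatrix_equiv_self Fin.revPerm]
  congr 1
  ext i j
  have hi := i.isLt
  have hj := j.isLt
  simp only [Matrix.submatrix_apply, Matrix.of_apply, Fin.revPerm_apply, Fin.val_rev]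
  have e : ((m + 1 + 1 : ℕ) : ℤ) - 2 * (((m + 1 + 1 - 1 - ((i : ℕ) + 1) : ℕ) : ℤ) + 1)
      + (((m + 1 + 1 - 1 - ((j : ℕ) + 1) : ℕ) : ℤ) + 1) = 2 * (i : ℕ) + 1 - (j : ℕ) := by
    omega
  rw [e]
  split_ifs with h
  · have hle : (j : ℕ) ≤ 2 * (i : ℕ) + 1 := by omega
    have ht : (2 * ((i : ℕ) : ℤ) + 1 - ((j : ℕ) : ℤ)).toNat = 2 * (i : ℕ) + 1 - (j : ℕ) := by omega
    rw [ht, ← Nat.factorial_mul_descFactorial hle]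
    have h1 : ((2 * (i : ℕ) + 1 - (j : ℕ)).factorial : ℚ) ≠ 0 := by positivity
    have h2 : ((2 * (i : ℕ) + 1).descFactorial j : ℚ) ≠ 0 := by
      have := Nat.descFactorial_eq_zero_iff_lt.not.mpr (not_lt.mpr hle)
      exact_mod_cast this
    push_cast
    field_simp
  · rw [Nat.descFactorial_eq_zero_iff_lt.mpr (by omega)]
    simp
end
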